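/- Suppose that for each j ≥ 1 the function λ ↦ λ g_j(λ) is Lipschitz continuous on [0,κ²] with Lipschitz constant at most j. Let x_1,…,x_N be independent samples drawn from ρ. Then for every f ∈ H, every τ ≥ 1 and every t > 0, with probability at least 1 − 2e^{−t}, ||Σ_{j≤τ} (T_j − T̂_j) f|| ≤ C ||f|| κ² √t τ N^{−1/2}, where C is a universal constant. -/

import Mathlib

open MeasureTheory Filter
open scoped ENNReal

local notation "⟪" x ", " y "⟫" => @inner ℂ _ _ x y

theorem Real.cosh_le_of_sq_le {a c θ r : ℝ} (hθ : |θ| ≤ 1)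
    (hr : r ^ 2 ≤ a ^ 2 + c ^ 2 + 2 * (a * c * θ)) :
    Real.cosh r ≤ Real.cosh a * Real.cosh c + θ * (Real.sinh a * Real.sinh c) := by
  obtain ⟨h1, h2⟩ := abs_le.1 hθ
  have key : Real.cosh r ≤
      (1 + θ) / 2 * Real.cosh (a + c) + (1 - θ) / 2 * Real.cosh (a - c) := by
    refine hasSum_le (fun n => ?_) (Real.hasSum_cosh r)
      (((Real.hasSum_cosh (a + c)).mul_left _).add ((Real.hasSum_cosh (a - c)).mul_left _))
    have h3 : r ^ 2 ≤ (1 + θ) / 2 * (a + c) ^ 2 + (1 - θ) / 2 * (a - c) ^ 2 := by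
      linarith
    have h4 := (convexOn_pow n).2 (Set.mem_Ici.2 (sq_nonneg (a + c)))
      (Set.mem_Ici.2 (sq_nonneg (a - c))) (by linarith : 0 ≤ (1 + θ) / 2)
      (by linarith : 0 ≤ (1 - θ) / 2) (by ring)
    simp only [smul_eq_mul] at h4
    have h5 := (pow_le_pow_left₀ (sq_nonneg r) h3 n).trans h4
    simp only [pow_mul, mul_div_assoc']
    rw [← add_div]
    gcongr
  rw [Real.cosh_add, Real.cosh_sub] at key
  linarith

section InnerProduct

variable {E : Type*} [NormedAddCommGroup E] [InnerProductSpace ℂ E]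

theorem cosh_norm_add_le {s x : E} {c : ℝ} (hx : ‖x‖ ≤ c) :
    Real.cosh ‖s + x‖ ≤ Real.cosh ‖s‖ * Real.cosh c +
      RCLike.re ⟪s, x⟫ / (‖s‖ * c) * (Real.sinh ‖s‖ * Real.sinh c) := by
  have hc : 0 ≤ c := (norm_nonneg x).trans hx
  have hin : |RCLike.re ⟪s, x⟫| ≤ ‖s‖ * c :=
    (RCLike.abs_re_le_norm _).trans ((norm_inner_le_norm s x).trans (by gcongr))
  apply Real.cosh_le_of_sq_le
  · rw [abs_div, abs_of_nonneg (by positivity : 0 ≤ ‖s‖ * c)]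
    exact div_le_one_of_le₀ hin (by positivity)
  · have h : ‖s‖ * c * (RCLike.re ⟪s, x⟫ / (‖s‖ * c)) = RCLike.re ⟪s, x⟫ := by
      rcases eq_or_ne (‖s‖ * c) 0 with h0 | h0
      · rw [h0, abs_nonpos_iff] at hin
        rw [hin]; simp
      · exact mul_div_cancel₀ _ h0
    rw [h, norm_add_sq (𝕜 := ℂ)]
    have : ‖x‖ ^ 2 ≤ c ^ 2 := by gcongr
    linarith

variable {X : Type*} [MeasurableSpace X] (ρ : Measure X) [IsProbabilityMeasure ρ]

theorem lintegral_cosh_norm_add_le [CompleteSpace E] {Y : X → E} (hY : StronglyMeasurable Y)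
    {c : ℝ} (hc : ∀ x, ‖Y x‖ ≤ c) (h0 : ∫ x, Y x ∂ρ = 0) (s : E) :
    ∫⁻ x, ENNReal.ofReal (Real.cosh ‖s + Y x‖) ∂ρ ≤
      ENNReal.ofReal (Real.cosh ‖s‖ * Real.cosh c) := by
  have hint : Integrable Y ρ :=
    Integrable.of_bound hY.aestronglyMeasurable c (ae_of_all _ hc)
  have hin : Integrable (fun x => RCLike.re ⟪s, Y x⟫) ρ := (hint.const_inner s).re
  have hz : ∫ x, RCLike.re ⟪s, Y x⟫ ∂ρ = 0 := by
    rw [integral_re (hint.const_inner s), integral_inner hint, h0]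
    simp
  set d : ℝ := (Real.sinh ‖s‖ * Real.sinh c) / (‖s‖ * c)
  have hle : ∀ x, Real.cosh ‖s + Y x‖ ≤
      Real.cosh ‖s‖ * Real.cosh c + RCLike.re ⟪s, Y x⟫ * d := fun x => by
    refine (cosh_norm_add_le (hc x)).trans_eq ?_
    simp only [d]
    ring
  have hin' : Integrable (fun x => Real.cosh ‖s‖ * Real.cosh c + RCLike.re ⟪s, Y x⟫ * d) ρ :=
    (integrable_const _).add (hin.mul_const d)
  calc ∫⁻ x, ENNReal.ofReal (Real.cosh ‖s + Y x‖) ∂ρ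
      ≤ ∫⁻ x, ENNReal.ofReal (Real.cosh ‖s‖ * Real.cosh c + RCLike.re ⟪s, Y x⟫ * d) ∂ρ :=
        lintegral_mono fun x => ENNReal.ofReal_le_ofReal (hle x)
    _ = ENNReal.ofReal (∫ x, (Real.cosh ‖s‖ * Real.cosh c + RCLike.re ⟪s, Y x⟫ * d) ∂ρ) :=
        (ofReal_integral_eq_lintegral_ofReal hin'
          (ae_of_all _ fun x => (Real.cosh_pos _).le.trans (hle x))).symm
    _ = ENNReal.ofReal (Real.cosh ‖s‖ * Real.cosh c) := by
        rw [integral_add (integrable_const _) (hin.mul_const d),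
          integral_mul_const d fun x => RCLike.re ⟪s, Y x⟫, hz]
        simp

theorem lintegral_pi_cosh_norm_sum_le [CompleteSpace E] {Y : X → E} (hY : StronglyMeasurable Y)
    {c : ℝ} (hc : ∀ x, ‖Y x‖ ≤ c) (h0 : ∫ x, Y x ∂ρ = 0) (N : ℕ) (s : E) :
    ∫⁻ xs, ENNReal.ofReal (Real.cosh ‖s + ∑ i, Y (xs i)‖) ∂(Measure.pi fun _ : Fin N => ρ) ≤
      ENNReal.ofReal (Real.cosh ‖s‖ * Real.cosh c ^ N) := by
  induction N generalizing s with
  | zero => simp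
  | succ N ih =>
    have hmeas : Measurable fun p : X × (Fin N → X) =>
        ENNReal.ofReal (Real.cosh ‖s + Y p.1 + ∑ i, Y (p.2 i)‖) := by
      have h1 : StronglyMeasurable fun p : X × (Fin N → X) =>
          s + Y p.1 + ∑ i, Y (p.2 i) :=
        (stronglyMeasurable_const.add (hY.comp_measurable measurable_fst)).add
          (Finset.stronglyMeasurable_fun_sum _ fun i _ =>
            hY.comp_measurable ((measurable_pi_apply i).comp measurable_snd))
      exact (Real.measurable_cosh.comp h1.norm.measurable).ennreal_ofReal
    have hmp := measurePreserving_piFinSuccAbove (fun _ : Fin (N + 1) => ρ) 0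
    calc ∫⁻ xs, ENNReal.ofReal (Real.cosh ‖s + ∑ i, Y (xs i)‖)
            ∂(Measure.pi fun _ : Fin (N + 1) => ρ)
        = ∫⁻ p, ENNReal.ofReal (Real.cosh ‖s + Y p.1 + ∑ i, Y (p.2 i)‖)
            ∂(ρ.prod (Measure.pi fun _ : Fin N => ρ)) := by
          rw [← hmp.lintegral_comp hmeas]
          refine lintegral_congr fun xs => ?_
          simp [Fin.sum_univ_succ, add_assoc, MeasurableEquiv.piFinSuccAbove, 
            Fin.insertNthEquiv, Fin.tail]
      _ = ∫⁻ x, ∫⁻ xs, ENNReal.ofReal (Real.cosh ‖s + Y x + ∑ i, Y (xs i)‖)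
            ∂(Measure.pi fun _ : Fin N => ρ) ∂ρ := lintegral_prod _ hmeas.aemeasurable
      _ ≤ ∫⁻ x, ENNReal.ofReal (Real.cosh ‖s + Y x‖) * ENNReal.ofReal (Real.cosh c ^ N) ∂ρ := by
          refine lintegral_mono fun x => (ih (s + Y x)).trans_eq ?_
          rw [ENNReal.ofReal_mul (Real.cosh_pos _).le]
      _ = (∫⁻ x, ENNReal.ofReal (Real.cosh ‖s + Y x‖) ∂ρ) * ENNReal.ofReal (Real.cosh c ^ N) :=
          lintegral_mul_const' _ _ ENNReal.ofReal_ne_top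
      _ ≤ ENNReal.ofReal (Real.cosh ‖s‖ * Real.cosh c) * ENNReal.ofReal (Real.cosh c ^ N) := by
          gcongr
          exact lintegral_cosh_norm_add_le ρ hY hc h0 s
      _ = ENNReal.ofReal (Real.cosh ‖s‖ * Real.cosh c ^ (N + 1)) := by
          have := Real.cosh_pos ‖s‖
          have := Real.cosh_pos c
          rw [← ENNReal.ofReal_mul (by positivity)]
          ring_nf

/-- **Hoeffding's inequality in Hilbert space** (Pinelis). -/
theorem measure_pi_norm_sum_le_ge [CompleteSpace E] {Y : X → E} (hY : StronglyMeasurable Y)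
    {c : ℝ} (hc0 : 0 < c) (hc : ∀ x, ‖Y x‖ ≤ c) (h0 : ∫ x, Y x ∂ρ = 0) {N : ℕ} (hN : 1 ≤ N)
    {t : ℝ} (ht : 0 < t) :
    ENNReal.ofReal (1 - 2 * Real.exp (-t)) ≤ Measure.pi (fun _ : Fin N => ρ)
      {xs | ‖∑ i, Y (xs i)‖ ≤ c * Real.sqrt (2 * N * t)} := by
  have hNpos : (0 : ℝ) < N := by exact_mod_cast hN
  set P := Measure.pi (fun _ : Fin N => ρ)
  set S := {xs : Fin N → X | ‖∑ i, Y (xs i)‖ ≤ c * Real.sqrt (2 * N * t)} with hS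
  set b := Real.sqrt (2 * N * t) / N with hb
  have hsq : Real.sqrt (2 * N * t) ^ 2 = 2 * N * t := Real.sq_sqrt (by positivity)
  have hspos : 0 < Real.sqrt (2 * N * t) := Real.sqrt_pos.2 (by positivity)
  have hbpos : 0 < b := by positivity
  have hsum : StronglyMeasurable fun xs : Fin N → X => ∑ i, Y (xs i) :=
    Finset.stronglyMeasurable_fun_sum _ fun i _ => hY.comp_measurable (measurable_pi_apply i)
  have hSm : MeasurableSet S := measurableSet_le hsum.norm.measurable measurable_const
  have hscaled (x : X) : ‖((b / c : ℝ) : ℂ) • Y x‖ ≤ b := by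
    rw [norm_smul, Complex.norm_real, Real.norm_of_nonneg (by positivity)]
    calc b / c * ‖Y x‖ ≤ b / c * c := by gcongr; exact hc x
      _ = b := by field_simp
  have hmgf := lintegral_pi_cosh_norm_sum_le ρ (hY.const_smul ((b / c : ℝ) : ℂ))
    hscaled (by rw [show (∫ x, (((b / c : ℝ) : ℂ) • Y) x ∂ρ) = _ from
      integral_smul _ _, h0, smul_zero]) N 0
  have hcosh : Real.cosh ‖(0 : E)‖ * Real.cosh b ^ N ≤ Real.exp t := by
    rw [norm_zero, Real.cosh_zero, one_mul]
    calc Real.cosh b ^ N ≤ Real.exp (b ^ 2 / 2) ^ N := by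
          gcongr
          exact Real.cosh_le_exp_half_sq b
      _ = Real.exp t := by
          rw [← Real.exp_nat_mul]
          congr 1
          rw [hb, div_pow, hsq]
          field_simp
  have hcompl : P Sᶜ * ENNReal.ofReal (Real.exp (2 * t) / 2) ≤ ENNReal.ofReal (Real.exp t) := by
    calc P Sᶜ * ENNReal.ofReal (Real.exp (2 * t) / 2)
        = ∫⁻ xs in Sᶜ, ENNReal.ofReal (Real.exp (2 * t) / 2) ∂P := by
          rw [setLIntegral_const, mul_comm]
      _ ≤ ∫⁻ xs in Sᶜ, ENNReal.ofReal
            (Real.cosh ‖0 + ∑ i, (((b / c : ℝ) : ℂ) • Y) (xs i)‖) ∂P := by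
          refine setLIntegral_mono' hSm.compl fun xs hxs => ENNReal.ofReal_le_ofReal ?_
          have hlt : c * Real.sqrt (2 * N * t) < ‖∑ i, Y (xs i)‖ := by
            simpa [hS] using hxs
          have h2 : 2 * t ≤ ‖0 + ∑ i, (((b / c : ℝ) : ℂ) • Y) (xs i)‖ := by
            simp only [Pi.smul_apply, zero_add, ← Finset.smul_sum]
            rw [norm_smul, Complex.norm_real, Real.norm_of_nonneg (by positivity)]
            calc 2 * t = b / c * (c * Real.sqrt (2 * N * t)) := by
                  rw [show b / c * (c * Real.sqrt (2 * N * t)) = Real.sqrt (2 * N * t) ^ 2 / N by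
                    rw [hb]; field_simp, hsq]
                  field_simp
              _ ≤ _ := by gcongr
          have h3 := Real.exp_le_exp.2 h2
          rw [Real.cosh_eq]
          have := Real.exp_pos (-‖0 + ∑ i, (((b / c : ℝ) : ℂ) • Y) (xs i)‖)
          linarith
      _ ≤ ∫⁻ xs, ENNReal.ofReal
            (Real.cosh ‖0 + ∑ i, (((b / c : ℝ) : ℂ) • Y) (xs i)‖) ∂P :=
          setLIntegral_le_lintegral _ _
      _ ≤ ENNReal.ofReal (Real.exp t) := hmgf.trans (ENNReal.ofReal_le_ofReal hcosh)
  have hcompl' : P Sᶜ ≤ ENNReal.ofReal (2 * Real.exp (-t)) := by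
    rw [← ENNReal.le_div_iff_mul_le (Or.inl (by simp; positivity)) (Or.inl ENNReal.ofReal_ne_top),
      ← ENNReal.ofReal_div_of_pos (by positivity)] at hcompl
    refine hcompl.trans_eq (congrArg _ ?_)
    rw [Real.exp_neg, two_mul t, Real.exp_add]
    field_simp
  rw [ENNReal.ofReal_sub _ (by positivity), ENNReal.ofReal_one, tsub_le_iff_right]
  calc (1 : ℝ≥0∞) = P S + P Sᶜ := by rw [measure_add_measure_compl hSm, measure_univ]
    _ ≤ _ := by gcongr

end InnerProduct

section HilbertSchmidt

variable {H : Type*} [NormedAddCommGroup H] [InnerProductSpace ℂ H] {ι : Type*}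

theorem HilbertBasis.hasSum_norm_inner_sq (v : HilbertBasis ι ℂ H) (f : H) :
    HasSum (fun i => ‖⟪v i, f⟫‖ ^ 2) (‖f‖ ^ 2) := by
  have h := Complex.hasSum_re (v.hasSum_inner_mul_inner f f)
  have h1 : (⟪f, f⟫).re = ‖f‖ ^ 2 := by
    rw [inner_self_eq_norm_sq_to_K]; norm_cast
  rw [h1] at h
  convert h using 2 with i
  rw [← inner_conj_symm f, Complex.conj_mul']
  norm_cast

/-- An operator is bounded by its Hilbert–Schmidt norm. -/
theorem HilbertBasis.norm_apply_le_of_sum_sq_le (v : HilbertBasis ι ℂ H) (A : H →L[ℂ] H)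
    {ε : ℝ} (hε : 0 ≤ ε) (hA : ∀ s : Finset ι, ∑ i ∈ s, ‖A (v i)‖ ^ 2 ≤ ε ^ 2) (f : H) :
    ‖A f‖ ≤ ε * ‖f‖ := by
  have hsum : HasSum (fun i => A (v.repr f i • v i)) (A f) := (v.hasSum_repr f).mapL A
  refine le_of_tendsto hsum.norm (Eventually.of_forall fun s => ?_)
  calc ‖∑ i ∈ s, A (v.repr f i • v i)‖ ≤ ∑ i ∈ s, ‖A (v i)‖ * ‖⟪v i, f⟫‖ := by
        refine (norm_sum_le _ _).trans_eq (Finset.sum_congr rfl fun i _ => ?_)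
        rw [map_smul, norm_smul, v.repr_apply_apply, mul_comm]
    _ ≤ Real.sqrt (∑ i ∈ s, ‖A (v i)‖ ^ 2) * Real.sqrt (∑ i ∈ s, ‖⟪v i, f⟫‖ ^ 2) :=
        Real.sum_mul_le_sqrt_mul_sqrt _ _ _
    _ ≤ ε * ‖f‖ := by
        gcongr
        · exact (Real.sqrt_le_left hε).2 (hA s)
        · exact (Real.sqrt_le_left (norm_nonneg f)).2 (v.orthonormal.sum_inner_products_le f)

end HilbertSchmidt

section Diagonal

variable {H : Type*} [NormedAddCommGroup H] [InnerProductSpace ℂ H] [CompleteSpace H]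
  {ι ι' : Type*}

/-- A bounded operator diagonal in a Hilbert basis with real eigenvalues is symmetric. -/
theorem HilbertBasis.inner_apply_of_diagonal (v : HilbertBasis ι ℂ H) {A : H →L[ℂ] H}
    {a : ι → ℝ} (hA : ∀ i, A (v i) = (a i : ℂ) • v i) (f g : H) :
    ⟪A f, g⟫ = ⟪f, A g⟫ := by
  have hv (k : ι) (f : H) : ⟪v k, A f⟫ = (a k : ℂ) * ⟪v k, f⟫ := by
    have hadj : ContinuousLinearMap.adjoint A (v k) = (a k : ℂ) • v k := by
      refine v.repr.injective (lp.ext (funext fun i => ?_))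
      rw [v.repr_apply_apply, v.repr_apply_apply, ContinuousLinearMap.adjoint_inner_right, hA,
        inner_smul_left, inner_smul_right, Complex.conj_ofReal]
      classical
      simp only [orthonormal_iff_ite.1 v.orthonormal]
      split_ifs with h
      · rw [h]
      · simp
    rw [← ContinuousLinearMap.adjoint_inner_left, hadj, inner_smul_left, Complex.conj_ofReal]
  rw [← v.tsum_inner_mul_inner (A f) g, ← v.tsum_inner_mul_inner f (A g)]
  refine tsum_congr fun i => ?_
  rw [hv, ← inner_conj_symm (A f), hv, map_mul, Complex.conj_ofReal, inner_conj_symm]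
  ring

theorem HilbertBasis.norm_apply_sub_basis_le (v : HilbertBasis ι ℂ H) (w : HilbertBasis ι' ℂ H)
    {A B T S : H →L[ℂ] H} {μ a : ι → ℝ} {ν b : ι' → ℝ}
    (hT : ∀ i, T (v i) = (μ i : ℂ) • v i) (hA : ∀ i, A (v i) = (a i : ℂ) • v i)
    (hS : ∀ k, S (w k) = (ν k : ℂ) • w k) (hB : ∀ k, B (w k) = (b k : ℂ) • w k)
    {L : ℝ} (hL : 0 ≤ L) (hab : ∀ i k, |a i - b k| ≤ L * |μ i - ν k|) (i : ι) :
    ‖A (v i) - B (v i)‖ ≤ L * ‖T (v i) - S (v i)‖ := by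
  refine abs_le_of_sq_le_sq' ?_ (by positivity) |>.2
  rw [mul_pow]
  refine hasSum_le (fun k => ?_) (w.hasSum_norm_inner_sq _)
    ((w.hasSum_norm_inner_sq _).mul_left _)
  have h1 : ⟪w k, A (v i) - B (v i)⟫ = ((a i - b k : ℝ) : ℂ) * ⟪w k, v i⟫ := by
    rw [inner_sub_right, ← w.inner_apply_of_diagonal hB, hA, hB, inner_smul_left,
      inner_smul_right, Complex.conj_ofReal]
    push_cast; ring
  have h2 : ⟪w k, T (v i) - S (v i)⟫ = ((μ i - ν k : ℝ) : ℂ) * ⟪w k, v i⟫ := by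
    rw [inner_sub_right, ← w.inner_apply_of_diagonal hS, hT, hS, inner_smul_left,
      inner_smul_right, Complex.conj_ofReal]
    push_cast; ring
  rw [h1, h2, norm_mul, norm_mul, Complex.norm_real, Complex.norm_real, Real.norm_eq_abs,
    Real.norm_eq_abs, ← mul_pow, ← mul_assoc]
  gcongr
  exact hab i k

end Diagonal

section RankOne

variable {H : Type*} [NormedAddCommGroup H] [InnerProductSpace ℂ H] {ι : Type*}

/-- The rank one operator `⟪k, ·⟫ • k` as a Hilbert–Schmidt operator, represented by its values
on a Hilbert basis. -/
noncomputable def HilbertBasis.rankOne (v : HilbertBasis ι ℂ H) (k : H) :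
    lp (fun _ : ι => H) 2 :=
  ⟨fun i => ⟪k, v i⟫ • k, memℓp_gen <| by
    have h := (v.summable_inner_mul_inner k k).norm.mul_right (‖k‖ ^ 2)
    refine h.congr fun i => ?_
    rw [norm_mul, norm_inner_symm (v i), norm_smul]
    norm_num
    ring⟩

theorem HilbertBasis.rankOne_apply (v : HilbertBasis ι ℂ H) (k : H) (i : ι) :
    v.rankOne k i = ⟪k, v i⟫ • k := rfl

theorem HilbertBasis.inner_rankOne (v : HilbertBasis ι ℂ H) (k l : H) :
    ⟪v.rankOne k, v.rankOne l⟫ = ⟪l, k⟫ * ⟪k, l⟫ := by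
  rw [lp.inner_eq_tsum, ← v.tsum_inner_mul_inner l k, ← tsum_mul_right]
  refine tsum_congr fun i => ?_
  rw [v.rankOne_apply, v.rankOne_apply, inner_smul_left, inner_smul_right, inner_conj_symm]
  ring

theorem HilbertBasis.norm_rankOne (v : HilbertBasis ι ℂ H) (k : H) :
    ‖v.rankOne k‖ = ‖k‖ ^ 2 := by
  have h := inner_self_eq_norm_sq_to_K (𝕜 := ℂ) (v.rankOne k)
  rw [v.inner_rankOne, inner_self_eq_norm_sq_to_K] at h
  have h' : ‖k‖ ^ 2 * ‖k‖ ^ 2 = ‖v.rankOne k‖ ^ 2 := by exact_mod_cast h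
  rw [← sq] at h'
  exact ((sq_eq_sq₀ (by positivity) (norm_nonneg _)).1 h').symm

theorem HilbertBasis.continuous_rankOne (v : HilbertBasis ι ℂ H) : Continuous v.rankOne := by
  refine continuous_iff_continuousAt.2 fun k => ?_
  rw [ContinuousAt, tendsto_iff_norm_sub_tendsto_zero]
  have h (l : H) : ‖v.rankOne l - v.rankOne k‖ =
      Real.sqrt ((‖l‖ ^ 2) ^ 2 - 2 * RCLike.re (⟪k, l⟫ * ⟪l, k⟫) + (‖k‖ ^ 2) ^ 2) := by
    rw [← v.norm_rankOne, ← v.norm_rankOne, ← v.inner_rankOne, ← norm_sub_sq,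
      Real.sqrt_sq (norm_nonneg _)]
  have hc : Continuous fun l => ‖v.rankOne l - v.rankOne k‖ := by
    simp only [h]
    fun_prop
  simpa using hc.tendsto k

end RankOne

section Frame

variable {H : Type*} [NormedAddCommGroup H] [InnerProductSpace ℂ H] {ι X : Type*} {K : X → H}

theorem HilbertBasis.eigenvalue_mem_Icc (w : HilbertBasis ι ℂ H) {T : H →L[ℂ] H} {ν : ι → ℝ}
    (hν : ∀ i, T (w i) = (ν i : ℂ) • w i) {N : ℕ} (hN : 1 ≤ N) {xs : Fin N → X}
    (hT : ∀ f, T f = (N : ℂ)⁻¹ • ∑ i, ⟪K (xs i), f⟫ • K (xs i)) {κ : ℝ}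
    (hκ : ∀ x, ‖K x‖ ≤ κ) (i : ι) : ν i ∈ Set.Icc 0 (κ ^ 2) := by
  have hNpos : (0 : ℝ) < N := by exact_mod_cast hN
  have hw : ‖w i‖ = 1 := w.orthonormal.1 i
  have h1 : ν i = (N : ℝ)⁻¹ * ∑ k, ‖⟪K (xs k), w i⟫‖ ^ 2 := by
    have h2 : ⟪w i, T (w i)⟫ = (ν i : ℂ) := by
      rw [hν, inner_smul_right, inner_self_eq_norm_sq_to_K, hw]
      simp
    have h3 : ⟪w i, T (w i)⟫ = (((N : ℝ)⁻¹ * ∑ k, ‖⟪K (xs k), w i⟫‖ ^ 2 : ℝ) : ℂ) := by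
      rw [hT, inner_smul_right, inner_sum]
      push_cast
      congr 1
      refine Finset.sum_congr rfl fun k _ => ?_
      rw [inner_smul_right, ← inner_conj_symm (w i), Complex.mul_conj']
    exact_mod_cast h2.symm.trans h3
  have hle (k : Fin N) : ‖⟪K (xs k), w i⟫‖ ^ 2 ≤ κ ^ 2 := by
    have := norm_inner_le_norm (𝕜 := ℂ) (K (xs k)) (w i)
    rw [hw, mul_one] at this
    exact pow_le_pow_left₀ (norm_nonneg _) (this.trans (hκ _)) 2
  refine ⟨h1 ▸ by positivity, ?_⟩
  rw [h1, inv_mul_le_iff₀ hNpos]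
  simpa using Finset.sum_le_card_nsmul Finset.univ _ _ fun k _ => hle k

variable [CompleteSpace H]

theorem HilbertBasis.sum_frame_eq (v : HilbertBasis ι ℂ H) {A T : H →L[ℂ] H} {a : ι → ℝ}
    (hA : ∀ i, A (v i) = (a i : ℂ) • v i) {N : ℕ} {xs : Fin N → X}
    (hT : ∀ f, T f = (N : ℂ)⁻¹ • ∑ i, ⟪K (xs i), f⟫ • K (xs i)) (f : H) :
    (N : ℂ)⁻¹ • ∑ i, ⟪A (K (xs i)), f⟫ • A (K (xs i)) = A (T (A f)) := by
  simp only [hT, map_smul, map_sum, v.inner_apply_of_diagonal hA]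

/-- The frame operator of `x ↦ A (K x)`, for `A` symmetric and `T` the frame operator of `K`. -/
theorem HilbertBasis.integral_frame_eq [MeasurableSpace X] {ρ : Measure X}
    (v : HilbertBasis ι ℂ H) {A T : H →L[ℂ] H} {a : ι → ℝ}
    (hA : ∀ i, A (v i) = (a i : ℂ) • v i) (hT : ∀ f, T f = ∫ x, ⟪K x, f⟫ • K x ∂ρ)
    (hK : ∀ f, Integrable (fun x => ⟪K x, f⟫ • K x) ρ) (f : H) :
    ∫ x, ⟪A (K x), f⟫ • A (K x) ∂ρ = A (T (A f)) := by
  rw [hT, ← A.integral_comp_comm (hK _)]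
  simp only [map_smul, v.inner_apply_of_diagonal hA]

end Frame

/-- The coordinates of a Bochner integral in `ℓ²`. -/
theorem lp.integral_apply {X : Type*} [MeasurableSpace X] {ρ : Measure X} {H : Type*}
    [NormedAddCommGroup H] [InnerProductSpace ℂ H] [CompleteSpace H] {ι : Type*}
    {F : X → lp (fun _ : ι => H) 2} (hF : Integrable F ρ) (i : ι)
    (hFi : Integrable (fun x => F x i) ρ) : (∫ x, F x ∂ρ) i = ∫ x, F x i ∂ρ := by
  classical
  refine ext_inner_left ℂ fun a => ?_
  rw [← lp.inner_single_left (𝕜 := ℂ) (G := fun _ : ι => H), ← integral_inner hF,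
    ← integral_inner hFi]
  simp only [lp.inner_single_left]

theorem sum_sq_filter_eq {g G : ℕ → ℝ → ℝ} (hg0 : ∀ j l, 0 ≤ l → 0 ≤ g j l)
    (hg : ∀ j l, 0 ≤ l → g j l ≤ g (j + 1) l) (hG0 : ∀ l, G 0 l = Real.sqrt (g 0 l))
    (hG : ∀ j l, G (j + 1) l = Real.sqrt (g (j + 1) l - g j l)) {l : ℝ} (hl : 0 ≤ l) (m : ℕ) :
    ∑ j ∈ Finset.Iic m, G j l ^ 2 = g m l := by
  rw [← Nat.range_succ_eq_Iic]
  induction m with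
  | zero => simp [hG0, Real.sq_sqrt (hg0 0 l hl)]
  | succ m ih =>
    rw [Finset.sum_range_succ, ih, hG, Real.sq_sqrt (sub_nonneg.2 (hg m l hl))]
    ring

theorem sum_frame_apply_basis {H : Type*} [NormedAddCommGroup H] [InnerProductSpace ℂ H]
    {g G : ℕ → ℝ → ℝ} (hg0 : ∀ j l, 0 ≤ l → 0 ≤ g j l)
    (hg : ∀ j l, 0 ≤ l → g j l ≤ g (j + 1) l) (hG0 : ∀ l, G 0 l = Real.sqrt (g 0 l))
    (hG : ∀ j l, G (j + 1) l = Real.sqrt (g (j + 1) l - g j l)) {l : ℝ} (hl : 0 ≤ l) (m : ℕ)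
    {T : H →L[ℂ] H} {A : ℕ → H →L[ℂ] H} {e : H} (hT : T e = (l : ℂ) • e)
    (hA : ∀ j, A j e = (G j l : ℂ) • e) :
    (∑ j ∈ Finset.Iic m, A j ∘L T ∘L A j) e = ((l * g m l : ℝ) : ℂ) • e := by
  rw [← sum_sq_filter_eq hg0 hg hG0 hG hl m, sum_apply, Finset.mul_sum,
    Complex.ofReal_sum, Finset.sum_smul]
  refine Finset.sum_congr rfl fun j _ => ?_
  simp only [ContinuousLinearMap.comp_apply, hA, hT, map_smul, smul_smul]
  push_cast
  ring_nf

/-- **Sampling error.** There is a universal constant `C` such that the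
following holds. Suppose that for each `j ≥ 1` the function `λ ↦ λ g_j(λ)` is Lipschitz on
`[0,κ²]` with constant at most `j`, and let `x_1,…,x_N` be independent samples from `ρ` (a
point of `X^N` with law `ρ^{⊗N}`). Then for every `f ∈ H`, `τ ≥ 1` and `t > 0`, with
probability at least `1 − 2e^{−t}`,
`‖Σ_{j≤τ} (T_j − T̂_j) f‖ ≤ C ‖f‖ κ² √t τ N^{−1/2}`.

Encoding: the RKHS is given by the feature map `K : X → H`; `T` (resp. the empirical operator
`T̂ = That xs`) is diagonalized by the Hilbert basis `v` (resp. `vh xs`) with eigenvalues `μ`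
(resp. `μh xs`); `G_j(T)` (resp. `G_j(T̂)`) is the operator `Gt j` (resp. `Gth j xs`) acting
as `G j` on the respective eigenvalues, with the filters `G` built from `g` by
`G_0 = √g_0`, `G_{j+1} = √(g_{j+1} − g_j)`; `T_j f = ∫ ⟨f,ψ_{j,x}⟩ ψ_{j,x} dρ(x)` and
`T̂_j f = (1/N) Σ_i ⟨f,ψ̂_{j,x_i}⟩ ψ̂_{j,x_i}` with `ψ_{j,x} = G_j(T) K_x`,
`ψ̂_{j,x_i} = G_j(T̂) K_{x_i}`. -/
theorem stmt7 :
    ∃ C : ℝ, 0 < C ∧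
      ∀ (X : Type) [TopologicalSpace X] [LocallyCompactSpace X] [SecondCountableTopology X]
        [MeasurableSpace X] [BorelSpace X]
        (ρ : Measure X) [IsProbabilityMeasure ρ]
        (H : Type) [NormedAddCommGroup H] [InnerProductSpace ℂ H] [CompleteSpace H]
        (K : X → H), Continuous K →
      ∀ κ : ℝ, 0 < κ → (∀ x, ‖K x‖ ≤ κ) →
      ∀ g : ℕ → ℝ → ℝ,
        (∀ j l, 0 ≤ l → 0 ≤ g j l) →
        (∀ j l, 0 ≤ l → g j l ≤ g (j + 1) l) →
        (∀ l ∈ Set.Ioc (0:ℝ) (κ ^ 2),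
          Tendsto (fun j : ℕ => l * g j l) atTop (nhds 1)) →
        (∀ j : ℕ, 1 ≤ j → ∀ a ∈ Set.Icc (0:ℝ) (κ ^ 2), ∀ b ∈ Set.Icc (0:ℝ) (κ ^ 2),
          |a * g j a - b * g j b| ≤ (j : ℝ) * |a - b|) →
      ∀ G : ℕ → ℝ → ℝ,
        (∀ l, G 0 l = Real.sqrt (g 0 l)) →
        (∀ j l, G (j + 1) l = Real.sqrt (g (j + 1) l - g j l)) →
      ∀ (ι : Type) (v : HilbertBasis ι ℂ H) (μ : ι → ℝ),
        (∀ i, 0 ≤ μ i ∧ μ i ≤ κ ^ 2) →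
      ∀ T : H →L[ℂ] H, (∀ f, T f = ∫ x, ⟪K x, f⟫ • K x ∂ρ) →
        (∀ i, T (v i) = ((μ i : ℝ) : ℂ) • v i) →
      ∀ Gt : ℕ → H →L[ℂ] H, (∀ j i, Gt j (v i) = ((G j (μ i) : ℝ) : ℂ) • v i) →
      ∀ N : ℕ, 1 ≤ N →
      ∀ That : (Fin N → X) → H →L[ℂ] H,
        (∀ xs f, That xs f = (N : ℂ)⁻¹ • ∑ i, ⟪K (xs i), f⟫ • K (xs i)) →
      ∀ (ι' : Type) (vh : (Fin N → X) → HilbertBasis ι' ℂ H)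
        (μh : (Fin N → X) → ι' → ℝ),
        (∀ xs i, That xs (vh xs i) = ((μh xs i : ℝ) : ℂ) • vh xs i) →
      ∀ Gth : ℕ → (Fin N → X) → H →L[ℂ] H,
        (∀ j xs i, Gth j xs (vh xs i) = ((G j (μh xs i) : ℝ) : ℂ) • vh xs i) →
      ∀ f : H, ∀ τ : ℝ, 1 ≤ τ → ∀ t : ℝ, 0 < t →
        ENNReal.ofReal (1 - 2 * Real.exp (-t)) ≤
          Measure.pi (fun _ : Fin N => ρ)
            {xs | ‖∑ j ∈ Finset.Iic ⌊τ⌋₊,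
                ((∫ x, ⟪Gt j (K x), f⟫ • Gt j (K x) ∂ρ) -
                  (N : ℂ)⁻¹ •
                    ∑ i, ⟪Gth j xs (K (xs i)), f⟫ • Gth j xs (K (xs i)))‖ ≤
              C * ‖f‖ * κ ^ 2 * Real.sqrt t * τ / Real.sqrt N} := by
  refine ⟨2 * Real.sqrt 2, by positivity, ?_⟩
  intro X _ _ _ _ _ ρ _ H _ _ _ K hK κ hκ hKκ g hg0 hg _ hLip G hG0 hG ι v μ hμ T hT hTv Gt hGt
    N hN That hThat ι' vh μh hμh Gth hGth f τ hτ t ht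
  have hNpos : (0 : ℝ) < N := by exact_mod_cast hN
  have hsm : StronglyMeasurable fun x => v.rankOne (K x) :=
    (v.continuous_rankOne.comp hK).stronglyMeasurable
  have hbound (x : X) : ‖v.rankOne (K x)‖ ≤ κ ^ 2 := by
    rw [v.norm_rankOne]
    exact pow_le_pow_left₀ (norm_nonneg _) (hKκ x) 2
  have hint : Integrable (fun x => v.rankOne (K x)) ρ :=
    Integrable.of_bound hsm.aestronglyMeasurable (κ ^ 2) (ae_of_all _ hbound)
  have hKint (f : H) : Integrable (fun x => ⟪K x, f⟫ • K x) ρ := by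
    have hc : Continuous fun x => ⟪K x, f⟫ • K x := by fun_prop
    refine Integrable.of_bound hc.stronglyMeasurable.aestronglyMeasurable (κ * ‖f‖ * κ)
      (ae_of_all _ fun x => ?_)
    rw [norm_smul]
    gcongr
    · exact (norm_inner_le_norm _ _).trans (by gcongr; exact hKκ x)
    · exact hKκ x
  set Φ := ∫ x, v.rankOne (K x) ∂ρ with hΦ
  have hΦi (i : ι) : Φ i = T (v i) := by
    rw [hΦ, lp.integral_apply hint i (hKint (v i)), hT]
    rfl
  have hΦle : ‖Φ‖ ≤ κ ^ 2 := by
    simpa using norm_integral_le_of_norm_le_const (ae_of_all ρ hbound)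
  have hcentered : ∫ x, (v.rankOne (K x) - Φ) ∂ρ = 0 := by
    rw [integral_sub hint (integrable_const _)]
    simp [hΦ]
  refine (measure_pi_norm_sum_le_ge ρ (Y := fun x => v.rankOne (K x) - Φ)
    (hsm.sub stronglyMeasurable_const) (c := 2 * κ ^ 2) (by positivity)
    (fun x => (norm_sub_le _ _).trans (by linarith [hbound x]))
    hcentered hN ht).trans
    (measure_mono fun xs hxs => ?_)
  simp only [Set.mem_ofPred_eq] at hxs ⊢
  set D := ∑ i, (v.rankOne (K (xs i)) - Φ) with hD
  set m := ⌊τ⌋₊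
  have hm : 1 ≤ m := Nat.one_le_floor_iff _ |>.2 hτ
  have hmτ : (m : ℝ) ≤ τ := Nat.floor_le (by linarith)
  have hDi (i : ι) : ‖T (v i) - That xs (v i)‖ = (N : ℝ)⁻¹ * ‖D i‖ := by
    have hDsum : D i = (N : ℂ) • (That xs (v i) - T (v i)) := by
      rw [hD, Finset.sum_sub_distrib, hThat, ← hΦi, smul_sub, smul_smul,
        mul_inv_cancel₀ (by exact_mod_cast hNpos.ne'), one_smul]
      simp only [lp.coeFn_sub, lp.coeFn_sum, Pi.sub_apply, Finset.sum_const, Finset.card_univ,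
        Fintype.card_fin, Nat.cast_smul_eq_nsmul]
      exact congrArg (· - _) (Finset.sum_apply _ _ _)
    rw [hDsum, norm_smul, Complex.norm_natCast, inv_mul_cancel_left₀ hNpos.ne', norm_sub_rev]
  have hsumD (s : Finset ι) : ∑ i ∈ s, ‖D i‖ ^ 2 ≤ ‖D‖ ^ 2 := by
    have := lp.sum_rpow_le_norm_rpow (p := 2) (by norm_num) D s
    simpa using this
  set A := ∑ j ∈ Finset.Iic m, Gt j ∘L T ∘L Gt j
  set B := ∑ j ∈ Finset.Iic m, Gth j xs ∘L That xs ∘L Gth j xs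
  have hν := (vh xs).eigenvalue_mem_Icc (hμh xs) hN (hThat xs) hKκ
  have hA (i : ι) : A (v i) = ((μ i * g m (μ i) : ℝ) : ℂ) • v i :=
    sum_frame_apply_basis hg0 hg hG0 hG (hμ i).1 m (hTv i) fun j => hGt j i
  have hB (k : ι') : B (vh xs k) = ((μh xs k * g m (μh xs k) : ℝ) : ℂ) • vh xs k :=
    sum_frame_apply_basis hg0 hg hG0 hG (hν k).1 m (hμh xs k) fun j => hGth j xs k
  have hAB := v.norm_apply_sub_basis_le (vh xs) hTv hA (hμh xs) hB (Nat.cast_nonneg m)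
    fun i k => hLip m hm _ (hμ i) _ (hν k)
  have hmain : ‖(A - B) f‖ ≤ m * ((N : ℝ)⁻¹ * ‖D‖) * ‖f‖ := by
    refine v.norm_apply_le_of_sum_sq_le _ (by positivity) (fun s => ?_) f
    calc ∑ i ∈ s, ‖(A - B) (v i)‖ ^ 2 ≤ ∑ i ∈ s, (m * (N : ℝ)⁻¹) ^ 2 * ‖D i‖ ^ 2 := by
          refine Finset.sum_le_sum fun i _ => ?_
          rw [← mul_pow, mul_assoc, ← hDi]
          exact pow_le_pow_left₀ (norm_nonneg _) (hAB i) 2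
      _ ≤ (m * (N : ℝ)⁻¹) ^ 2 * ‖D‖ ^ 2 := by
          rw [← Finset.mul_sum]
          gcongr
          exact hsumD s
      _ = (m * ((N : ℝ)⁻¹ * ‖D‖)) ^ 2 := by ring
  have hframe : ∑ j ∈ Finset.Iic m, ((∫ x, ⟪Gt j (K x), f⟫ • Gt j (K x) ∂ρ) -
      (N : ℂ)⁻¹ • ∑ i, ⟪Gth j xs (K (xs i)), f⟫ • Gth j xs (K (xs i))) = (A - B) f := by
    simp only [v.integral_frame_eq (hGt _) hT hKint,
      (vh xs).sum_frame_eq (hGth _ xs) (hThat xs), Finset.sum_sub_distrib, A, B,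
      sub_apply, sum_apply,
      ContinuousLinearMap.comp_apply]
  rw [hframe]
  calc ‖(A - B) f‖ ≤ m * ((N : ℝ)⁻¹ * ‖D‖) * ‖f‖ := hmain
    _ ≤ τ * ((N : ℝ)⁻¹ * (2 * κ ^ 2 * Real.sqrt (2 * N * t))) * ‖f‖ := by gcongr
    _ = 2 * Real.sqrt 2 * ‖f‖ * κ ^ 2 * Real.sqrt t * τ / Real.sqrt N := by
        have hs : Real.sqrt N ≠ 0 := (Real.sqrt_pos.2 hNpos).ne'
        rw [Real.sqrt_mul (by positivity), Real.sqrt_mul (by norm_num)]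
        nth_rewrite 1 [← Real.sq_sqrt hNpos.le]
        field_simp
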